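/- arXiv:1105.5287 — 3 statements merged into one kernel-verified Lean document; each statement's English description precedes it below -/
import Mathlib

section
/- Let m ≥ 1 be an integer. Then the sum over k = 0, 1, …, ⌊(m+1)/2⌋ of the squares of the numbers f(m+1−k, k) of standard Young tableaux of the two-row shapes (m+1−k, k) equals the number f(m+1, m+1) of standard Young tableaux of shape (m+1, m+1) (a partition of 2m+2). Equivalently (Theorem 4.9 of the paper): Σ_{k=0}^{⌊(m+1)/2⌋} (dim S^{(m+1−k,k)})² = dim S^{(m+1,m+1)}, where S^λ denotes the Specht module of the symmetric group over any field (its dimension is independent of the field and equals the number of standard Young tableaux of shape λ). -/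
open scoped Classical

/-- The number of standard Young tableaux of the two-row shape `(a, b)`
(with `a ≥ b`), encoded via the ballot condition: a tableau is determined by
the `b`-element set `S ⊆ {1, …, a+b}` of positions of the second-row entries,
subject to `2·|S ∩ {1,…,i}| ≤ i` for all `1 ≤ i ≤ a + b`.
(Positions are represented `0`-based by `Fin (a+b)`, position `i` in `{1,…,N}`
corresponding to the elements `x : Fin (a+b)` with `x.val < i`.) -/
noncomputable def twoRowSYT (a b : ℕ) : ℕ :=
  (Finset.univ.filter (fun S : Finset (Fin (a + b)) =>
    S.card = b ∧
      ∀ i ∈ Finset.Icc 1 (a + b),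
        2 * (S.filter (fun x : Fin (a + b) => (x : ℕ) < i)).card ≤ i)).card

/-- The subsets `S` of `{0, …, N - 1}` with `N = 2 * |S| + h` satisfying the ballot condition.
They encode the nonnegative lattice paths of `N` up- and down-steps from height `0` to height `h`,
with `S` the set of down-steps. -/
noncomputable def ballotSets (N h : ℕ) : Finset (Finset ℕ) :=
  (Finset.range N).powerset.filter fun S =>
    N = 2 * S.card + h ∧ ∀ i ∈ Finset.Icc 1 N, 2 * (S.filter (· < i)).card ≤ i

theorem mem_ballotSets {N h : ℕ} {S : Finset ℕ} :
    S ∈ ballotSets N h ↔ S ⊆ Finset.range N ∧ N = 2 * S.card + h ∧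
      ∀ i ∈ Finset.Icc 1 N, 2 * (S.filter (· < i)).card ≤ i := by
  simp [ballotSets]

theorem notMem_of_mem_ballotSets {N h : ℕ} {S : Finset ℕ} (hS : S ∈ ballotSets N h) : N ∉ S :=
  fun hN => by simpa using (mem_ballotSets.1 hS).1 hN

theorem filter_lt_insert_of_le {N i : ℕ} (S : Finset ℕ) (hi : i ≤ N) :
    (insert N S).filter (· < i) = S.filter (· < i) := by
  rw [Finset.filter_insert, if_neg (by omega)]

theorem mem_ballotSets_succ_of_notMem {N h : ℕ} {S : Finset ℕ} (hN : N ∉ S) :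
    S ∈ ballotSets (N + 1) h ↔ 0 < h ∧ S ∈ ballotSets N (h - 1) := by
  simp only [mem_ballotSets, Finset.mem_Icc]
  constructor
  · rintro ⟨hsub, hcard, hb⟩
    have hsub' : S ⊆ Finset.range N := by
      rwa [Finset.range_add_one, Finset.subset_insert_iff_of_notMem hN] at hsub
    have hlast := hb (N + 1) (by omega)
    have hpos : 0 < h := by
      rcases N.eq_zero_or_pos with rfl | hNpos
      · have : S = ∅ := by simpa using hsub'
        subst this
        simp at hcard
        omega
      · have hN' := hb N (by omega)
        rw [Finset.filter_true_of_mem fun x hx => Finset.mem_range.1 (hsub' hx)] at hN'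
        omega
    exact ⟨hpos, hsub', by omega, fun i hi => hb i (by omega)⟩
  · rintro ⟨hpos, hsub, hcard, hb⟩
    refine ⟨hsub.trans (Finset.range_subset_range.2 (by omega)), by omega, fun i hi => ?_⟩
    rcases Nat.lt_or_ge N i with h' | h'
    · have := Finset.card_filter_le S (· < i)
      omega
    · exact hb i (by omega)

theorem insert_mem_ballotSets_succ {N h : ℕ} {S : Finset ℕ} (hN : N ∉ S) :
    insert N S ∈ ballotSets (N + 1) h ↔ S ∈ ballotSets N (h + 1) := by
  simp only [mem_ballotSets, Finset.mem_Icc, Finset.card_insert_of_notMem hN, Finset.range_add_one,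
    Finset.insert_subset_insert_iff hN]
  refine and_congr_right fun _ => ?_
  constructor
  · rintro ⟨hcard, hb⟩
    refine ⟨by omega, fun i hi => ?_⟩
    simpa only [filter_lt_insert_of_le S hi.2] using hb i (by omega)
  · rintro ⟨hcard, hb⟩
    refine ⟨by omega, fun i hi => ?_⟩
    rcases Nat.lt_or_ge N i with h' | h'
    · have := Finset.card_filter_le (insert N S) (· < i)
      rw [Finset.card_insert_of_notMem hN] at this
      omega
    · simpa only [filter_lt_insert_of_le S h'] using hb i (by omega)

theorem card_filter_mem_ballotSets_succ (N h : ℕ) :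
    ((ballotSets (N + 1) h).filter (N ∈ ·)).card = (ballotSets N (h + 1)).card := by
  symm
  refine Finset.card_nbij' (insert N ·) (·.erase N) ?_ ?_ ?_ ?_
  · intro S hS
    simpa using (insert_mem_ballotSets_succ (notMem_of_mem_ballotSets hS)).2 hS
  · intro S hS
    obtain ⟨hS, hN⟩ := Finset.mem_filter.1 hS
    rw [← Finset.insert_erase hN] at hS
    exact (insert_mem_ballotSets_succ (Finset.notMem_erase N S)).1 hS
  · intro S hS
    exact Finset.erase_insert (notMem_of_mem_ballotSets hS)
  · intro S hS
    exact Finset.insert_erase (Finset.mem_filter.1 hS).2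

theorem card_ballotSets_succ_zero (N : ℕ) :
    (ballotSets (N + 1) 0).card = (ballotSets N 1).card := by
  rw [← card_filter_mem_ballotSets_succ, Finset.filter_true_of_mem]
  intro S hS
  by_contra hN
  simpa using (mem_ballotSets_succ_of_notMem hN).1 hS

theorem card_ballotSets_succ_succ (N h : ℕ) :
    (ballotSets (N + 1) (h + 1)).card
      = (ballotSets N h).card + (ballotSets N (h + 2)).card := by
  rw [← Finset.card_filter_add_card_filter_not (N ∈ ·), card_filter_mem_ballotSets_succ, add_comm]
  congr 2
  ext S
  rw [Finset.mem_filter]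
  constructor
  · rintro ⟨hS, hN⟩
    exact ((mem_ballotSets_succ_of_notMem hN).1 hS).2
  · intro hS
    have hN := notMem_of_mem_ballotSets hS
    exact ⟨(mem_ballotSets_succ_of_notMem hN).2 ⟨h.succ_pos, hS⟩, hN⟩

theorem card_ballotSets_zero (h : ℕ) : (ballotSets 0 h).card = if h = 0 then 1 else 0 := by
  split_ifs with hh
  · refine Finset.card_eq_one.2 ⟨∅, Finset.ext fun S => ?_⟩
    simp +contextual [mem_ballotSets, hh]
  · rw [Finset.card_eq_zero, Finset.eq_empty_iff_forall_notMem]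
    intro S hS
    have := (mem_ballotSets.1 hS).2.1
    omega

theorem exists_eq_of_card_ballotSets_ne_zero {N h : ℕ} (H : (ballotSets N h).card ≠ 0) :
    ∃ k, N = 2 * k + h := by
  obtain ⟨S, hS⟩ := Finset.card_ne_zero.1 H
  exact ⟨S.card, (mem_ballotSets.1 hS).2.1⟩

theorem card_ballotSets_of_lt {N h : ℕ} (H : N < h) : (ballotSets N h).card = 0 := by
  by_contra hne
  obtain ⟨k, hk⟩ := exists_eq_of_card_ballotSets_ne_zero hne
  omega

theorem sum_card_ballotSets_succ_mul {n m H : ℕ} (hm : m ≤ H) :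
    ∑ h ∈ Finset.range (H + 1), (ballotSets (n + 1) h).card * (ballotSets m h).card
      = ∑ h ∈ Finset.range (H + 1), (ballotSets n (h + 1)).card * (ballotSets m h).card
        + ∑ h ∈ Finset.range (H + 1), (ballotSets n h).card * (ballotSets m (h + 1)).card := by
  rw [Finset.sum_range_succ' _ H, Finset.sum_range_succ' _ H,
    Finset.sum_range_succ (fun h => (ballotSets n h).card * (ballotSets m (h + 1)).card) H,
    card_ballotSets_of_lt (Nat.lt_succ_of_le hm), card_ballotSets_succ_zero]
  simp only [card_ballotSets_succ_succ, add_mul, Finset.sum_add_distrib]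
  ring

theorem sum_card_ballotSets_succ_mul_comm {n m H : ℕ} (hn : n ≤ H) (hm : m ≤ H) :
    ∑ h ∈ Finset.range (H + 1), (ballotSets (n + 1) h).card * (ballotSets m h).card
      = ∑ h ∈ Finset.range (H + 1), (ballotSets n h).card * (ballotSets (m + 1) h).card := by
  simp only [mul_comm (ballotSets n _).card (ballotSets (m + 1) _).card]
  rw [sum_card_ballotSets_succ_mul hm, sum_card_ballotSets_succ_mul hn, add_comm]
  simp only [mul_comm]

theorem sum_card_ballotSets_mul {n m H : ℕ} (hH : n + m ≤ H) :
    ∑ h ∈ Finset.range (H + 1), (ballotSets n h).card * (ballotSets m h).card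
      = (ballotSets (n + m) 0).card := by
  induction n generalizing m with
  | zero => simp [card_ballotSets_zero]
  | succ n ih =>
    rw [sum_card_ballotSets_succ_mul_comm (by omega) (by omega), ih (by omega)]
    congr 2
    omega

theorem card_filter_map_valEmbedding {N : ℕ} (S : Finset (Fin N)) (i : ℕ) :
    ((S.map Fin.valEmbedding).filter (· < i)).card = (S.filter fun x : Fin N => (x : ℕ) < i).card := by
  rw [Finset.filter_map, Finset.card_map]
  rfl

theorem twoRowSYT_eq_card_ballotSets {a b : ℕ} (hab : b ≤ a) :
    twoRowSYT a b = (ballotSets (a + b) (a - b)).card := by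
  refine Finset.card_bij (fun S _ => S.map Fin.valEmbedding) ?_ ?_ ?_
  · intro S hS
    obtain ⟨hcard, hb⟩ := ((@Finset.mem_filter _ _ (_) _ _).1 hS).2
    refine mem_ballotSets.2 ⟨fun x hx => ?_, ?_, fun i hi => ?_⟩
    · obtain ⟨y, -, rfl⟩ := Finset.mem_map.1 hx
      exact Finset.mem_range.2 y.2
    · rw [Finset.card_map]
      omega
    · rw [card_filter_map_valEmbedding]
      exact hb i hi
  · intro S _ T _ h
    exact Finset.map_injective _ h
  · intro S hS
    obtain ⟨hsub, hcard, hb⟩ := mem_ballotSets.1 hS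
    have hmap : (S.attachFin fun x hx => Finset.mem_range.1 (hsub hx)).map Fin.valEmbedding = S :=
      Finset.map_valEmbedding_attachFin _
    refine ⟨_, (@Finset.mem_filter _ _ (_) _ _).2
      ⟨Finset.mem_univ _, ?_, fun i hi => ?_⟩, hmap⟩
    · rw [Finset.card_attachFin]
      omega
    · rw [← card_filter_map_valEmbedding, hmap]
      exact hb i hi

/-- Theorem 4.9 of the paper:
`Σ_{k=0}^{⌊(m+1)/2⌋} (dim S^{(m+1−k,k)})² = dim S^{(m+1,m+1)}`, where the
dimension of the Specht module `S^λ` (over any field) equals the number of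
standard Young tableaux of shape `λ`. -/
theorem sum_squares_twoRowSYT_eq (m : ℕ) (hm : 1 ≤ m) :
    ∑ k ∈ Finset.range ((m + 1) / 2 + 1), (twoRowSYT (m + 1 - k) k) ^ 2
      = twoRowSYT (m + 1) (m + 1) := by
  rw [twoRowSYT_eq_card_ballotSets le_rfl, Nat.sub_self, ← sum_card_ballotSets_mul le_rfl]
  refine Finset.sum_of_injOn (fun k => m + 1 - 2 * k) ?_ ?_ ?_ ?_
  · intro k hk l hl h
    simp only [Finset.coe_range, Set.mem_Iio] at hk hl h
    omega
  · intro k hk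
    simp only [Finset.coe_range, Set.mem_Iio] at hk ⊢
    omega
  · intro h _ hnot
    by_contra hne
    obtain ⟨k, hk⟩ := exists_eq_of_card_ballotSets_ne_zero (left_ne_zero_of_mul hne)
    refine hnot ⟨k, ?_, ?_⟩
    · simp only [Finset.coe_range, Set.mem_Iio]
      omega
    · dsimp only
      omega
  · intro k hk
    rw [Finset.mem_range] at hk
    rw [twoRowSYT_eq_card_ballotSets (by omega), sq, show m + 1 - k + k = m + 1 by omega,
      show m + 1 - k - k = m + 1 - 2 * k by omega]
end

section
/- For every integer m ≥ 1, Σ_{k=0}^{⌊(m+1)/2⌋} (C(m+1, k) − C(m+1, k−1))² = Catalan(m+1), where C(n, j) denotes the binomial coefficient (with the convention C(m+1, −1) = 0, so the k = 0 term equals 1) and Catalan(m+1) = C(2m+2, m+1)/(m+2) is the (m+1)-st Catalan number. (This is the combinatorial identity of Theorem 4.9/Corollary 4.10 of the paper, since C(m+1,k) − C(m+1,k−1) is the number of standard Young tableaux of shape (m+1−k, k) and Catalan(m+1) is the number of standard Young tableaux of shape (m+1, m+1).) -/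
open Finset in
/-- A function symmetric about `(n + 1) / 2` and vanishing at that point when it is an integer has
twice its lower half sum as total sum. -/
theorem sum_range_add_two_eq_two_mul_of_symm (n : ℕ) (g : ℕ → ℤ)
    (hsymm : ∀ k ≤ n + 1, g (n + 1 - k) = g k) (hmid : ∀ k, 2 * k = n + 1 → g k = 0) :
    ∑ k ∈ range (n + 2), g k = 2 * ∑ k ∈ range (n / 2 + 1), g k := by
  have hupper : ∑ k ∈ range (n / 2 + 1), g (n + 1 - n / 2 + k) = ∑ k ∈ range (n / 2 + 1), g k := by
    rw [← sum_range_reflect g]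
    refine sum_congr rfl fun k hk => ?_
    rw [mem_range] at hk
    rw [← hsymm _ (by lia)]
    congr 1
    lia
  have hlower : ∑ k ∈ range (n + 1 - n / 2), g k = ∑ k ∈ range (n / 2 + 1), g k := by
    obtain h | h : n + 1 - n / 2 = n / 2 + 1 ∨ n + 1 - n / 2 = n / 2 + 1 + 1 := by lia
    · rw [h]
    · rw [h, sum_range_succ, hmid _ (by lia), add_zero]
  rw [show n + 2 = (n + 1 - n / 2) + (n / 2 + 1) by lia, sum_range_add, hupper, hlower, two_mul]

open Finset in
theorem sum_range_choose_succ_mul_choose (n : ℕ) :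
    ∑ k ∈ range (n + 1), n.choose (k + 1) * n.choose k = (2 * n).choose (n + 1) := by
  rw [two_mul, Nat.add_choose_eq, Nat.sum_antidiagonal_eq_sum_range_succ_mk,
    sum_range_succ' _ (n + 1)]
  simp only [Nat.sub_zero, Nat.choose_succ_self, mul_zero, add_zero]
  refine sum_congr rfl fun k hk => ?_
  rw [Nat.add_sub_add_right, Nat.choose_symm (by simpa [Nat.lt_succ_iff] using hk)]

theorem catalan_eq_choose_sub_choose (n : ℕ) :
    (catalan n : ℤ) = (2 * n).choose n - (2 * n).choose (n + 1) := by
  have h₁ := succ_mul_catalan_eq_centralBinom n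
  have h₂ := Nat.choose_succ_right_eq (2 * n) n
  rw [Nat.centralBinom] at h₁
  rw [show 2 * n - n = n by lia] at h₂
  zify at h₁ h₂
  refine mul_left_cancel₀ (by positivity : (n + 1 : ℤ) ≠ 0) ?_
  linear_combination h₁ + h₂

open Finset in
theorem sum_range_add_two_sq_choose_diff (n : ℕ) :
    ∑ k ∈ range (n + 2), ((n.choose k : ℤ) - (if k = 0 then 0 else (n.choose (k - 1) : ℤ))) ^ 2
      = 2 * ((2 * n).choose n - (2 * n).choose (n + 1)) := by
  have hsq : ∑ k ∈ range (n + 1), (n.choose k : ℤ) ^ 2 = (2 * n).choose n := by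
    exact_mod_cast Nat.sum_range_choose_sq n
  have hshift : ∑ k ∈ range (n + 1), (n.choose (k + 1) : ℤ) ^ 2 + 1 = (2 * n).choose n := by
    have h := sum_range_succ' (fun k => (n.choose k : ℤ) ^ 2) (n + 1)
    rw [sum_range_succ, hsq] at h
    simpa using h.symm
  have hmul : ∑ k ∈ range (n + 1), (n.choose (k + 1) : ℤ) * n.choose k
      = (2 * n).choose (n + 1) := by
    exact_mod_cast sum_range_choose_succ_mul_choose n
  rw [sum_range_succ']
  simp only [Nat.add_one_ne_zero, if_false, if_true, Nat.add_sub_cancel, sub_sq, sum_add_distrib,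
    sum_sub_distrib, mul_assoc, ← mul_sum, hsq, hmul, Nat.choose_zero_right]
  push_cast
  linear_combination hshift


/-- The combinatorial identity of Theorem 4.9 / Corollary 4.10 of the paper:
`Σ_{k=0}^{⌊(m+1)/2⌋} (C(m+1,k) − C(m+1,k−1))² = Catalan(m+1)`,
with the convention `C(m+1,−1) = 0` (so the `k = 0` term equals `1`). -/
theorem sum_sq_choose_diff_eq_catalan (m : ℕ) (hm : 1 ≤ m) :
    ∑ k ∈ Finset.range ((m + 1) / 2 + 1),
      (((m + 1).choose k : ℤ) - (if k = 0 then 0 else ((m + 1).choose (k - 1) : ℤ))) ^ 2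
      = (catalan (m + 1) : ℤ) := by
  refine mul_left_cancel₀ (two_ne_zero : (2 : ℤ) ≠ 0) ?_
  rw [catalan_eq_choose_sub_choose, ← sum_range_add_two_sq_choose_diff]
  refine (sum_range_add_two_eq_two_mul_of_symm (m + 1) _ (fun k hk => ?_) fun k hk => ?_).symm
  · rcases Nat.eq_zero_or_pos k with rfl | hpos
    · simp
    obtain rfl | hlt := hk.eq_or_lt
    · simp
    have h₁ : (m + 1).choose (m + 1 + 1 - k) = (m + 1).choose (k - 1) :=
      Nat.choose_symm_of_eq_add (by lia)
    have h₂ : (m + 1).choose (m + 1 + 1 - k - 1) = (m + 1).choose k :=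
      Nat.choose_symm_of_eq_add (by lia)
    rw [if_neg (by lia), if_neg (by lia), h₁, h₂]
    ring
  · have h : (m + 1).choose k = (m + 1).choose (k - 1) := Nat.choose_symm_of_eq_add (by lia)
    rw [if_neg (by lia), h]
    ring
end

section
/- For every integer m ≥ 1 the following identity holds in ℚ: 1 + m² + Σ_{k=2}^{⌊(m+1)/2⌋} ( (m+1)·m·(m−1)⋯(m−k+3)·(m+2−2k) / k! )² = (2m+2)(2m+1)⋯(m+3) / (m+1)!. Here (m+1)·m⋯(m−k+3) is the descending product of k−1 consecutive integers starting at m+1 (equal to (m+1)!/(m−k+2)!), and (2m+2)(2m+1)⋯(m+3) = (2m+2)!/(m+2)!. -/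
/-- A sum of a palindromic sequence, whose middle term (if any) vanishes, is twice its first half. -/
theorem sum_range_eq_two_mul_sum_range_half (n : ℕ) (g : ℕ → ℚ)
    (hsymm : ∀ j < n, g (n - 1 - j) = g j) (hmid : ∀ j, n = 2 * j + 1 → g j = 0) :
    ∑ j ∈ Finset.range n, g j = 2 * ∑ j ∈ Finset.range (n / 2), g j := by
  obtain ⟨h, rfl | rfl⟩ := n.even_or_odd'
  · have hreflect : ∑ j ∈ Finset.range h, g (h + j) = ∑ j ∈ Finset.range h, g j := by
      rw [← Finset.sum_range_reflect]
      refine Finset.sum_congr rfl fun j hj => ?_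
      rw [Finset.mem_range] at hj
      rw [← hsymm j (by omega)]
      congr 1
      omega
    rw [show 2 * h / 2 = h by omega, two_mul h, Finset.sum_range_add, hreflect, two_mul]
  · have hreflect : ∑ j ∈ Finset.range h, g (h + 1 + j) = ∑ j ∈ Finset.range h, g j := by
      rw [← Finset.sum_range_reflect]
      refine Finset.sum_congr rfl fun j hj => ?_
      rw [Finset.mem_range] at hj
      rw [← hsymm j (by omega)]
      congr 1
      omega
    rw [show (2 * h + 1) / 2 = h by omega, show 2 * h + 1 = h + 1 + h by omega,
      Finset.sum_range_add, hreflect, Finset.sum_range_succ, hmid h rfl]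
    ring

theorem sum_range_choose_mul_choose_succ (n : ℕ) :
    ∑ j ∈ Finset.range n, n.choose j * n.choose (j + 1) = (2 * n).choose (n + 1) := by
  rw [two_mul, Nat.add_choose_eq, Finset.Nat.sum_antidiagonal_eq_sum_range_succ_mk,
    Finset.sum_range_succ, Finset.sum_range_succ']
  simp only [Nat.choose_succ_self, Nat.sub_zero, mul_zero, zero_mul, add_zero]
  refine Finset.sum_congr rfl fun j hj => ?_
  rw [Finset.mem_range] at hj
  rw [Nat.add_sub_add_right, Nat.choose_symm hj.le, mul_comm]

theorem sum_range_choose_succ_sub_choose_sq (n : ℕ) :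
    ∑ j ∈ Finset.range n, ((n.choose (j + 1) : ℚ) - n.choose j) ^ 2
      = 2 * ((2 * n).choose n - (2 * n).choose (n + 1) - 1) := by
  have hsq : ∑ j ∈ Finset.range (n + 1), (n.choose j : ℚ) ^ 2 = (2 * n).choose n := by
    exact_mod_cast Nat.sum_range_choose_sq n
  have hmul : ∑ j ∈ Finset.range n, (n.choose j : ℚ) * n.choose (j + 1)
      = (2 * n).choose (n + 1) := by
    exact_mod_cast sum_range_choose_mul_choose_succ n
  have hlow := hsq
  have hhigh := hsq
  rw [Finset.sum_range_succ] at hlow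
  rw [Finset.sum_range_succ'] at hhigh
  simp only [Nat.choose_self, Nat.choose_zero_right, Nat.cast_one, one_pow] at hlow hhigh
  have hexpand : ∑ j ∈ Finset.range n, ((n.choose (j + 1) : ℚ) - n.choose j) ^ 2
      = ∑ j ∈ Finset.range n, (n.choose (j + 1) : ℚ) ^ 2
        + ∑ j ∈ Finset.range n, (n.choose j : ℚ) ^ 2
        - 2 * ∑ j ∈ Finset.range n, (n.choose j : ℚ) * n.choose (j + 1) := by
    rw [Finset.mul_sum, ← Finset.sum_add_distrib, ← Finset.sum_sub_distrib]
    exact Finset.sum_congr rfl fun j _ => by ring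
  linarith

theorem one_add_sum_range_half_choose_succ_sub_choose_sq (n : ℕ) :
    1 + ∑ j ∈ Finset.range (n / 2), ((n.choose (j + 1) : ℚ) - n.choose j) ^ 2
      = (2 * n).choose n - (2 * n).choose (n + 1) := by
  have hhalf := sum_range_eq_two_mul_sum_range_half n
    (fun j => ((n.choose (j + 1) : ℚ) - n.choose j) ^ 2)
    (fun j hj => by
      have hleft : n.choose (n - 1 - j + 1) = n.choose j := by
        rw [← Nat.choose_symm hj.le]
        congr 1
        omega
      have hright : n.choose (n - 1 - j) = n.choose (j + 1) := by
        rw [← Nat.choose_symm (show j + 1 ≤ n from hj)]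
        congr 1
        omega
      simp only [hleft, hright]
      ring)
    (fun j hj => by
      subst hj
      simp [Nat.choose_symm_half])
  have hfull := sum_range_choose_succ_sub_choose_sq n
  linarith

theorem choose_sub_choose_succ_eq_factorial_div (n : ℕ) :
    ((2 * n).choose n : ℚ) - (2 * n).choose (n + 1)
      = (2 * n).factorial / ((n + 1).factorial * n.factorial) := by
  have hsucc : ((2 * n).choose (n + 1) : ℚ) * (n + 1) = (2 * n).choose n * n := by
    have h := Nat.choose_succ_right_eq (2 * n) n
    rw [show 2 * n - n = n by omega] at h
    exact_mod_cast h
  have hfact : ((2 * n).choose n : ℚ) * n.factorial * n.factorial = (2 * n).factorial := by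
    have h := Nat.choose_mul_factorial_mul_factorial (show n ≤ 2 * n by omega)
    rw [show 2 * n - n = n by omega] at h
    exact_mod_cast h
  rw [eq_div_iff (by positivity), ← hfact, Nat.factorial_succ]
  push_cast
  linear_combination (-(n.factorial : ℚ) * n.factorial) * hsucc

theorem descFactorial_mul_div_factorial_succ (n j : ℕ) (hj : j ≤ n) :
    (n.descFactorial j : ℚ) * ((n : ℚ) - 1 - 2 * j) / (j + 1).factorial
      = n.choose (j + 1) - n.choose j := by
  have hsucc : (n.choose (j + 1) : ℚ) * (j + 1) = n.choose j * (n - j) := by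
    rw [← Nat.cast_sub hj]
    exact_mod_cast Nat.choose_succ_right_eq n j
  rw [div_eq_iff (by positivity), Nat.descFactorial_eq_factorial_mul_choose, Nat.factorial_succ]
  push_cast
  linear_combination (-(j.factorial : ℚ)) * hsucc

/-- Corollary 4.10 of the paper: for every integer `m ≥ 1`, in `ℚ`,
`1 + m² + Σ_{k=2}^{⌊(m+1)/2⌋} ((m+1)·m⋯(m−k+3)·(m+2−2k)/k!)² = (2m+2)(2m+1)⋯(m+3)/(m+1)!`.
Here the descending product `(m+1)·m⋯(m−k+3)` of `k−1` factors is
`Nat.descFactorial (m+1) (k−1) = (m+1)!/(m−k+2)!`, and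
`(2m+2)(2m+1)⋯(m+3) = (2m+2)!/(m+2)!`. -/
theorem hook_length_identity (m : ℕ) (hm : 1 ≤ m) :
    1 + (m : ℚ) ^ 2 +
      ∑ k ∈ Finset.Icc 2 ((m + 1) / 2),
        ((((m + 1).descFactorial (k - 1) : ℚ) * ((m : ℚ) + 2 - 2 * (k : ℚ))) /
            (Nat.factorial k : ℚ)) ^ 2
      = ((2 * m + 2).factorial : ℚ) / (((m + 2).factorial : ℚ) * ((m + 1).factorial : ℚ)) := by
  obtain ⟨h, hh⟩ : ∃ h, (m + 1) / 2 = h + 1 := ⟨(m + 1) / 2 - 1, by omega⟩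
  have hcatalan := (one_add_sum_range_half_choose_succ_sub_choose_sq (m + 1)).trans
    (choose_sub_choose_succ_eq_factorial_div (m + 1))
  rw [show 2 * (m + 1) = 2 * m + 2 by ring, hh, Finset.sum_range_succ'] at hcatalan
  rw [← hcatalan, hh, ← Finset.Ico_add_one_right_eq_Icc, Finset.sum_Ico_eq_sum_range,
    show h + 1 + 1 - 2 = h by omega]
  have hterm : ∀ j ∈ Finset.range h,
      ((((m + 1).descFactorial (2 + j - 1) : ℚ) * ((m : ℚ) + 2 - 2 * ((2 + j : ℕ) : ℚ))) /
        ((2 + j).factorial : ℚ)) ^ 2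
      = (((m + 1).choose (j + 1 + 1) : ℚ) - (m + 1).choose (j + 1)) ^ 2 := by
    intro j hj
    rw [Finset.mem_range] at hj
    rw [← descFactorial_mul_div_factorial_succ (m + 1) (j + 1) (by omega),
      show 2 + j - 1 = j + 1 by omega, show 2 + j = j + 1 + 1 by omega]
    push_cast
    ring
  rw [Finset.sum_congr rfl hterm]
  simp only [zero_add, Nat.choose_one_right, Nat.choose_zero_right]
  push_cast
  ring
end
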